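/- arXiv:2309.05358 — 6 statements merged into one kernel-verified Lean document; each statement's English description precedes it below -/
import Mathlib

section
/- Let p > 1 be a real number and h > 0. Let V : ℤ × ℕ → ℝ be a nonnegative grid function satisfying the discrete nonlinear wave scheme V_i^{n+1} − 2V_i^n + V_i^{n−1} = V_{i+1}^n − 2V_i^n + V_{i−1}^n + h²·(V_i^n)^p for all i ∈ ℤ and n ≥ 1. Set Z_i^n = V_{i+1}^n − 2V_i^n + V_{i−1}^n. If Z_i^0 ≥ 0 for all i ∈ ℤ and Z_i^1 ≥ (Z_{i+1}^0 + Z_{i−1}^0)/2 for all i ∈ ℤ, then Z_i^n ≥ 0 for every i ∈ ℤ and every n ≥ 0. -/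
/-- A convex power preserves the discrete midpoint inequality `2 * c ≤ a + b`. -/
theorem two_mul_rpow_le_add_rpow {p a b c : ℝ} (hp : 1 ≤ p) (ha : 0 ≤ a) (hb : 0 ≤ b)
    (hc : 0 ≤ c) (h : 2 * c ≤ a + b) : 2 * c ^ p ≤ a ^ p + b ^ p := by
  have hconv := (convexOn_rpow hp).2 (Set.mem_Ici.2 ha) (Set.mem_Ici.2 hb)
    (by norm_num : (0 : ℝ) ≤ 1 / 2) (by norm_num : (0 : ℝ) ≤ 1 / 2) (by norm_num)
  simp only [smul_eq_mul] at hconv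
  have hmono : c ^ p ≤ (1 / 2 * a + 1 / 2 * b) ^ p :=
    Real.rpow_le_rpow hc (by linarith) (by linarith)
  linarith

/-- A grid function that is a supersolution of the discrete wave equation wherever it is
nonnegative dominates the discrete d'Alembert average of its initial data. -/
theorem discrete_dAlembert_le (Z : ℤ → ℕ → ℝ)
    (hZ : ∀ n, (∀ i, 0 ≤ Z i (n + 1)) →
      ∀ i, Z (i + 1) (n + 1) + Z (i - 1) (n + 1) ≤ Z i (n + 2) + Z i n)
    (hZ0 : ∀ i, 0 ≤ Z i 0)
    (hZ1 : ∀ i, (Z (i + 1) 0 + Z (i - 1) 0) / 2 ≤ Z i 1) (n : ℕ) :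
    (∀ i, (Z (i + n) 0 + Z (i - n) 0) / 2 ≤ Z i n) ∧
      ∀ i, (Z (i - n - 1) 0 - Z (i - n + 1) 0) / 2 ≤ Z i (n + 1) - Z (i + 1) n := by
  induction n with
  | zero =>
    refine ⟨fun i => by simp, fun i => ?_⟩
    have := hZ1 i
    simp only [Nat.cast_zero, sub_zero, zero_add]
    linarith
  | succ n ih =>
    obtain ⟨hlow, hdiff⟩ := ih
    have hlow' : ∀ i, (Z (i + (n + 1 : ℕ)) 0 + Z (i - (n + 1 : ℕ)) 0) / 2 ≤ Z i (n + 1) := by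
      intro i
      have h1 := hlow (i + 1)
      have h2 := hdiff i
      rw [show i + 1 + (n : ℤ) = i + (n + 1 : ℕ) by push_cast; ring,
        show i + 1 - (n : ℤ) = i - n + 1 by ring] at h1
      rw [show i - (n : ℤ) - 1 = i - (n + 1 : ℕ) by push_cast; ring] at h2
      linarith
    refine ⟨hlow', fun i => ?_⟩
    have hpos : ∀ j, 0 ≤ Z j (n + 1) := fun j => by
      linarith [hlow' j, hZ0 (j + (n + 1 : ℕ)), hZ0 (j - (n + 1 : ℕ))]
    have hsuper := hZ n hpos i
    have h2 := hdiff (i - 1)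
    rw [show i - 1 - (n : ℤ) = i - (n + 1 : ℕ) by push_cast; ring,
      show i - 1 + 1 = i by ring] at h2
    linarith

/-- Lemma 3.1: positivity of the discrete second space difference for the
discrete nonlinear wave scheme at CFL number 1. -/
theorem discrete_second_difference_nonneg
    (p h : ℝ) (hp : 1 < p) (hh : 0 < h)
    (V : ℤ → ℕ → ℝ)
    (hV_nonneg : ∀ i n, 0 ≤ V i n)
    (hscheme : ∀ i : ℤ, ∀ n : ℕ, 1 ≤ n →
      V i (n + 1) - 2 * V i n + V i (n - 1)
        = V (i + 1) n - 2 * V i n + V (i - 1) n + h ^ 2 * (V i n) ^ p)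
    (Z : ℤ → ℕ → ℝ)
    (hZ : ∀ i n, Z i n = V (i + 1) n - 2 * V i n + V (i - 1) n)
    (hZ0 : ∀ i, 0 ≤ Z i 0)
    (hZ1 : ∀ i, (Z (i + 1) 0 + Z (i - 1) 0) / 2 ≤ Z i 1) :
    ∀ i : ℤ, ∀ n : ℕ, 0 ≤ Z i n := by
  have hsuper : ∀ n, (∀ i, 0 ≤ Z i (n + 1)) →
      ∀ i, Z (i + 1) (n + 1) + Z (i - 1) (n + 1) ≤ Z i (n + 2) + Z i n := by
    intro n hpos i
    have hstep (j : ℤ) := hscheme j (n + 1) (by omega)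
    simp only [Nat.add_sub_cancel, add_assoc, Nat.reduceAdd] at hstep
    have hmid : 2 * V i (n + 1) ≤ V (i + 1) (n + 1) + V (i - 1) (n + 1) := by
      linarith [hpos i, hZ i (n + 1)]
    have hconv := mul_le_mul_of_nonneg_left
      (two_mul_rpow_le_add_rpow hp.le (hV_nonneg _ _) (hV_nonneg _ _) (hV_nonneg _ _) hmid)
      (sq_nonneg h)
    have hr := hstep (i + 1)
    have hl := hstep (i - 1)
    have hc := hstep i
    have zr := hZ (i + 1) (n + 1)
    have zl := hZ (i - 1) (n + 1)
    simp only [add_sub_cancel_right, sub_add_cancel, add_assoc, Int.reduceAdd] at hr hl zr zl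
    linarith [hZ i (n + 2), hZ i n]
  intro i n
  linarith [(discrete_dAlembert_le Z hsuper hZ0 hZ1 n).1 i, hZ0 (i + n), hZ0 (i - n)]
end

section
/- Let Z : ℤ × ℕ → ℝ satisfy the discrete wave inequality Z_i^{k+1} − 2Z_i^k + Z_i^{k−1} ≥ Z_{i+1}^k − 2Z_i^k + Z_{i−1}^k for all i ∈ ℤ and all k ≥ 1, and suppose Z_i^1 ≥ (Z_{i+1}^0 + Z_{i−1}^0)/2 for all i ∈ ℤ. Then for every i ∈ ℤ and every n ≥ 1, Z_i^n ≥ (Z_{i+n}^0 + Z_{i−n}^0)/2. -/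
/-- Telescoping the discrete wave inequality along a left-going characteristic bounds the
difference along a right-going one by the initial values. -/
theorem discrete_wave_inequality_characteristic_difference
    (Z : ℤ → ℕ → ℝ)
    (hwave : ∀ i : ℤ, ∀ k : ℕ, 1 ≤ k →
      Z (i + 1) k - 2 * Z i k + Z (i - 1) k
        ≤ Z i (k + 1) - 2 * Z i k + Z i (k - 1))
    (hZ1 : ∀ i : ℤ, (Z (i + 1) 0 + Z (i - 1) 0) / 2 ≤ Z i 1) (k : ℕ) (i : ℤ) :
    (Z (i - k - 1) 0 - Z (i - k + 1) 0) / 2 ≤ Z i (k + 1) - Z (i + 1) k := by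
  induction k generalizing i with
  | zero =>
    have h := hZ1 i
    simp only [Nat.cast_zero, sub_zero, zero_add]
    linarith
  | succ k ih =>
    have h := hwave i (k + 1) (by omega)
    have hk := ih (i - 1)
    rw [Nat.add_sub_cancel] at h
    rw [sub_add_cancel, show i - 1 - (k : ℤ) = i - ((k + 1 : ℕ) : ℤ) by push_cast; ring] at hk
    linarith

/-- Telescoping estimate from the proof of Lemma 3.1: a grid function
satisfying the discrete wave inequality at CFL number 1 is bounded below by
the average of its initial values along the characteristics. -/
theorem discrete_wave_inequality_telescoping
    (Z : ℤ → ℕ → ℝ)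
    (hwave : ∀ i : ℤ, ∀ k : ℕ, 1 ≤ k →
      Z (i + 1) k - 2 * Z i k + Z (i - 1) k
        ≤ Z i (k + 1) - 2 * Z i k + Z i (k - 1))
    (hZ1 : ∀ i : ℤ, (Z (i + 1) 0 + Z (i - 1) 0) / 2 ≤ Z i 1) :
    ∀ i : ℤ, ∀ n : ℕ, 1 ≤ n →
      (Z (i + (n : ℤ)) 0 + Z (i - (n : ℤ)) 0) / 2 ≤ Z i n := by
  intro i n _
  induction n generalizing i with
  | zero => simp
  | succ n ih =>
    have h := discrete_wave_inequality_characteristic_difference Z hwave hZ1 n i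
    have hn : (Z (i + 1 + n) 0 + Z (i + 1 - n) 0) / 2 ≤ Z (i + 1) n := by
      rcases n.eq_zero_or_pos with rfl | hpos
      · simp
      · exact ih (i + 1) hpos
    rw [show i + 1 + (n : ℤ) = i + ((n + 1 : ℕ) : ℤ) by push_cast; ring,
      show i + 1 - (n : ℤ) = i - n + 1 by ring] at hn
    rw [show i - (n : ℤ) - 1 = i - ((n + 1 : ℕ) : ℤ) by push_cast; ring] at h
    linarith
end

section
/- Let p > 1 be a real number and h > 0. Let V : ℤ × ℕ → ℝ be a nonnegative grid function satisfying the discrete nonlinear wave scheme V_i^{n+1} − 2V_i^n + V_i^{n−1} = V_{i+1}^n − 2V_i^n + V_{i−1}^n + h²·(V_i^n)^p for all i ∈ ℤ and n ≥ 1. Fix i ∈ ℤ and assume that V_{i+1}^n − 2V_i^n + V_{i−1}^n ≥ 0 for all n ≥ 1, that V_i^1 ≥ V_i^0, and that V_i^1 > 0. Then the numerical solution blows up at the node i, i.e. V_i^n → ∞ as n → ∞. -/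
open Filter

/-- A real sequence with nonnegative initial increment, positive value at `1`, and second
difference at `n` at least `c * u n ^ p` for all `n ≥ 1`, tends to infinity. -/
theorem tendsto_atTop_of_rpow_le_second_difference {u : ℕ → ℝ} {c p : ℝ} (hc : 0 < c)
    (h01 : u 0 ≤ u 1) (hpos : 0 < u 1)
    (hu : ∀ n, c * u (n + 1) ^ p ≤ u (n + 2) - 2 * u (n + 1) + u n) :
    Tendsto u atTop atTop := by
  set d := c * u 1 ^ p
  have hd_pos : 0 < d := by positivity
  have key : ∀ n : ℕ, u 1 + n * d ≤ u (n + 1) ∧ d ≤ u (n + 2) - u (n + 1) := by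
    intro n
    induction n with
    | zero =>
      have h0 := hu 0
      simp only [zero_add] at h0
      simp only [Nat.cast_zero, zero_mul, add_zero, zero_add, le_refl, true_and]
      linarith
    | succ n ih =>
      obtain ⟨hlow, hinc⟩ := ih
      have hnd : 0 ≤ (n : ℝ) * d := by positivity
      have hn : 0 ≤ c * u (n + 2) ^ p :=
        mul_nonneg hc.le (Real.rpow_nonneg (by linarith) p)
      have hstep : c * u (n + 2) ^ p ≤ u (n + 3) - 2 * u (n + 2) + u (n + 1) := hu (n + 1)
      change u 1 + ((n + 1 : ℕ) : ℝ) * d ≤ u (n + 2) ∧ d ≤ u (n + 3) - u (n + 2)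
      push_cast
      constructor <;> linarith
  rw [← tendsto_add_atTop_iff_nat 1]
  exact tendsto_atTop_mono (fun n => (key n).1) <|
    tendsto_atTop_add_const_left _ _ (tendsto_natCast_atTop_atTop.atTop_mul_const hd_pos)

/-- Lemma 3.2: under positivity of the discrete second space difference,
the solution of the discrete nonlinear wave scheme blows up (tends to ∞). -/
theorem discrete_solution_blows_up
    (p h : ℝ) (hp : 1 < p) (hh : 0 < h)
    (V : ℤ → ℕ → ℝ)
    (hV_nonneg : ∀ i n, 0 ≤ V i n)
    (hscheme : ∀ i : ℤ, ∀ n : ℕ, 1 ≤ n →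
      V i (n + 1) - 2 * V i n + V i (n - 1)
        = V (i + 1) n - 2 * V i n + V (i - 1) n + h ^ 2 * (V i n) ^ p)
    (i : ℤ)
    (hZ_nonneg : ∀ n : ℕ, 1 ≤ n → 0 ≤ V (i + 1) n - 2 * V i n + V (i - 1) n)
    (hmono : V i 0 ≤ V i 1)
    (hpos : 0 < V i 1) :
    Tendsto (fun n => V i n) atTop atTop := by
  refine tendsto_atTop_of_rpow_le_second_difference (u := V i) (c := h ^ 2) (p := p)
    (by positivity) hmono hpos fun n => ?_
  have hs := hscheme i (n + 1) (by omega)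
  have hz := hZ_nonneg (n + 1) (by omega)
  simp only [Nat.add_sub_cancel] at hs
  change _ ≤ V i (n + 1 + 1) - _ + _
  linarith
end

section
/- Let p > 1 be a real number and h > 0. Let V : ℤ × ℕ → ℝ be a nonnegative grid function satisfying the discrete nonlinear wave scheme V_i^{n+1} − 2V_i^n + V_i^{n−1} = V_{i+1}^n − 2V_i^n + V_{i−1}^n + h²·(V_i^n)^p for all i ∈ ℤ and n ≥ 1. Fix i ∈ ℤ and assume V_{i+1}^n − 2V_i^n + V_{i−1}^n ≥ 0 for all n ≥ 1 and V_i^1 ≥ V_i^0. Then for every n ≥ 1 the discrete energy inequality holds: ((V_i^{n+1} − V_i^n)/h)² ≥ ((V_i^1 − V_i^0)/h)² + (2/(p+1))·((V_i^n)^{p+1} − (V_i^0)^{p+1}). -/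
/-- The graph of `x ↦ x ^ (p + 1)` on the nonnegative reals lies above its tangent lines. -/
theorem rpow_add_one_sub_le_mul_sub {p a b : ℝ} (hp : 0 ≤ p) (ha : 0 ≤ a) (hb : 0 ≤ b) :
    b ^ (p + 1) - a ^ (p + 1) ≤ (p + 1) * (b ^ p * (b - a)) := by
  rcases hb.eq_or_lt with rfl | hb
  · have h₁ : (0 : ℝ) ^ (p + 1) = 0 := Real.zero_rpow (by linarith)
    have h₂ : 0 ≤ a ^ (p + 1) := Real.rpow_nonneg ha _
    rcases hp.eq_or_lt with rfl | hp
    · norm_num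
    · rw [h₁, Real.zero_rpow hp.ne']
      linarith
  · have bernoulli := one_add_mul_self_le_rpow_one_add (s := a / b - 1) (p := p + 1)
      (by linarith [div_nonneg ha hb.le]) (by linarith)
    rw [add_sub_cancel, Real.div_rpow ha hb.le, le_div_iff₀ (Real.rpow_pos_of_pos hb _)]
      at bernoulli
    have key : (1 + (p + 1) * (a / b - 1)) * b ^ (p + 1)
        = b ^ (p + 1) - (p + 1) * (b ^ p * (b - a)) := by
      rw [Real.rpow_add_one hb.ne']
      field_simp
      ring
    linarith

/-- The discrete energy inequality from the proof of Lemma 3.2. -/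
theorem discrete_energy_inequality
    (p h : ℝ) (hp : 1 < p) (hh : 0 < h)
    (V : ℤ → ℕ → ℝ)
    (hV_nonneg : ∀ i n, 0 ≤ V i n)
    (hscheme : ∀ i : ℤ, ∀ n : ℕ, 1 ≤ n →
      V i (n + 1) - 2 * V i n + V i (n - 1)
        = V (i + 1) n - 2 * V i n + V (i - 1) n + h ^ 2 * (V i n) ^ p)
    (i : ℤ)
    (hZ_nonneg : ∀ n : ℕ, 1 ≤ n → 0 ≤ V (i + 1) n - 2 * V i n + V (i - 1) n)
    (hmono : V i 0 ≤ V i 1) :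
    ∀ n : ℕ, 1 ≤ n →
      ((V i 1 - V i 0) / h) ^ 2
          + (2 / (p + 1)) * ((V i n) ^ (p + 1) - (V i 0) ^ (p + 1))
        ≤ ((V i (n + 1) - V i n) / h) ^ 2 := by
  have hstep (n : ℕ) : V i (n + 1) - V i n + h ^ 2 * V i (n + 1) ^ p
      ≤ V i (n + 2) - V i (n + 1) := by
    have h₁ := hscheme i (n + 1) (by omega)
    have h₂ := hZ_nonneg (n + 1) (by omega)
    simp only [add_tsub_cancel_right, add_assoc, Nat.reduceAdd] at h₁
    linarith
  have hforce (n : ℕ) : 0 ≤ h ^ 2 * V i n ^ p :=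
    mul_nonneg (sq_nonneg h) (Real.rpow_nonneg (hV_nonneg i n) p)
  have hdiff (n : ℕ) : 0 ≤ V i (n + 1) - V i n := by
    induction n with
    | zero => simpa using hmono
    | succ n ih => linarith [hstep n, hforce (n + 1)]
  have henergy (n : ℕ) : ((V i 1 - V i 0) / h) ^ 2
      + (2 / (p + 1)) * ((V i n) ^ (p + 1) - (V i 0) ^ (p + 1))
        ≤ ((V i (n + 1) - V i n) / h) ^ 2 := by
    induction n with
    | zero => simp
    | succ n ih =>
      have htangent : (2 / (p + 1)) * (V i (n + 1) ^ (p + 1) - V i n ^ (p + 1))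
          ≤ 2 * (V i (n + 1) ^ p * (V i (n + 1) - V i n)) := by
        rw [div_mul_eq_mul_div, div_le_iff₀ (by linarith)]
        linarith [rpow_add_one_sub_le_mul_sub (p := p) (by linarith) (hV_nonneg i n)
          (hV_nonneg i (n + 1))]
      have hincr : ((V i (n + 1) - V i n) / h) ^ 2
          + 2 * (V i (n + 1) ^ p * (V i (n + 1) - V i n))
            ≤ ((V i (n + 2) - V i (n + 1)) / h) ^ 2 := by
        have hsq : (V i (n + 1) - V i n) ^ 2
            + 2 * (h ^ 2 * V i (n + 1) ^ p) * (V i (n + 1) - V i n)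
              ≤ (V i (n + 2) - V i (n + 1)) ^ 2 := by
          have := pow_le_pow_left₀ (add_nonneg (hdiff n) (hforce (n + 1))) (hstep n) 2
          linarith [sq_nonneg (h ^ 2 * V i (n + 1) ^ p)]
        rw [div_pow, div_pow, le_div_iff₀ (by positivity), add_mul,
          div_mul_cancel₀ _ (by positivity)]
        linarith
      linarith
  exact fun n _ => henergy n
end

section
/- Let h > 0 and let b : ℤ × ℕ → ℝ be a grid function with b_i^n ≥ 0 for all i, n. Let Θ : ℤ × ℕ → ℝ satisfy, for all i ∈ ℤ and all n ≥ 2, the discrete inequality Θ_i^n − 2Θ_i^{n−1} + Θ_i^{n−2} ≥ Θ_{i+1}^{n−1} − 2Θ_i^{n−1} + Θ_{i−1}^{n−1} + h²·b_i^{n−1}·Θ_i^{n−1}. Assume moreover that for all i ∈ ℤ: Θ_i^0 ≥ 0, Θ_i^1 ≥ 0, and Θ_i^1 − Θ_{i+1}^0 ≥ 0. Then Θ_i^n ≥ 0 for all i ∈ ℤ and all n ≥ 0. -/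
/-- Lemma 3.3: the discrete maximum principle for the discrete wave operator
with a nonnegative zeroth-order coefficient, at CFL number 1. -/
theorem discrete_maximum_principle
    (h : ℝ) (hh : 0 < h)
    (b : ℤ → ℕ → ℝ) (hb : ∀ i n, 0 ≤ b i n)
    (Θ : ℤ → ℕ → ℝ)
    (hineq : ∀ i : ℤ, ∀ n : ℕ, 2 ≤ n →
      Θ (i + 1) (n - 1) - 2 * Θ i (n - 1) + Θ (i - 1) (n - 1)
          + h ^ 2 * b i (n - 1) * Θ i (n - 1)
        ≤ Θ i n - 2 * Θ i (n - 1) + Θ i (n - 2))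
    (h0 : ∀ i, 0 ≤ Θ i 0)
    (h1 : ∀ i, 0 ≤ Θ i 1)
    (h10 : ∀ i, 0 ≤ Θ i 1 - Θ (i + 1) 0) :
    ∀ i : ℤ, ∀ n : ℕ, 0 ≤ Θ i n := by
  have key : ∀ n : ℕ, ∀ i : ℤ, 0 ≤ Θ i n ∧ 0 ≤ Θ i (n + 1) - Θ (i + 1) n := by
    intro n
    induction n with
    | zero => exact fun i => ⟨h0 i, h10 i⟩
    | succ n ih =>
      have hpos : ∀ i, 0 ≤ Θ i (n + 1) := fun i => by
        linarith [(ih i).2, (ih (i + 1)).1]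
      refine fun i => ⟨hpos i, ?_⟩
      have hstep := hineq i (n + 2) (by omega)
      rw [show n + 2 - 1 = n + 1 by omega, Nat.add_sub_cancel] at hstep
      have hdiff := (ih (i - 1)).2
      rw [sub_add_cancel] at hdiff
      have hterm : 0 ≤ h ^ 2 * b i (n + 1) * Θ i (n + 1) :=
        mul_nonneg (mul_nonneg (sq_nonneg h) (hb i (n + 1))) (hpos i)
      linarith
  exact fun i n => (key n i).1
end

section
/- Let h > 0 and let c, Θ : ℤ × ℕ → ℝ be grid functions satisfying, for all i ∈ ℤ and all n ≥ 2, Θ_i^n ≥ Θ_{i+1}^{n−1} + Θ_{i−1}^{n−1} − Θ_i^{n−2} + c_i^{n−1}. Define W_i^n = Θ_i^n − Θ_{i+1}^{n−1} for n ≥ 1. Then for every i ∈ ℤ and every n ≥ 1, W_i^n ≥ W_{i−n+1}^1 + Σ_{l=1}^{n−1} c_{i+1−l}^{n−l}, and moreover Θ_i^n = Θ_{i+n}^0 + Σ_{k=0}^{n−1} W_{i+k}^{n−k}. -/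
/-- Iterating a one-step lower bound along the diagonal `(i, n) ↦ (i - 1, n - 1)`. -/
theorem add_sum_diagonal_le {W c : ℤ → ℕ → ℝ}
    (hstep : ∀ i n, W (i - 1) (n + 1) + c i (n + 1) ≤ W i (n + 2)) (i : ℤ) (m : ℕ) :
    W (i - m) 1 + ∑ l ∈ Finset.range m, c (i - l) (m - l) ≤ W i (m + 1) := by
  induction m generalizing i with
  | zero => simp
  | succ m ih =>
    have hi := ih (i - 1)
    have hs := hstep i m
    rw [Finset.sum_range_succ']
    simp only [Nat.cast_add, Nat.cast_one, Nat.cast_zero, sub_zero, Nat.sub_zero,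
      Nat.add_sub_add_right, sub_add_eq_sub_sub_swap]
    linarith

/-- A grid function is its initial value plus the sum of its differences along the
antidiagonal `(i, n) ↦ (i + 1, n - 1)`. -/
theorem eq_add_sum_antidiagonal {W Θ : ℤ → ℕ → ℝ}
    (hW : ∀ i n, W i (n + 1) = Θ i (n + 1) - Θ (i + 1) n) (i : ℤ) (n : ℕ) :
    Θ i n = Θ (i + n) 0 + ∑ k ∈ Finset.range n, W (i + k) (n - k) := by
  induction n generalizing i with
  | zero => simp
  | succ n ih =>
    have hi := ih (i + 1)
    have hs := hW i n
    rw [Finset.sum_range_succ']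
    simp only [Nat.cast_add, Nat.cast_one, Nat.cast_zero, add_zero, Nat.sub_zero,
      Nat.add_sub_add_right, add_comm _ (1 : ℤ), ← add_assoc] at hi hs ⊢
    linarith


/-- The telescoping identities for the characteristic difference
`W i n = Θ i n − Θ (i+1) (n−1)` used in the proof of the discrete maximum
principle (Lemma 3.3). -/
theorem characteristic_difference_telescoping
    (h : ℝ) (hh : 0 < h)
    (c Θ : ℤ → ℕ → ℝ)
    (hineq : ∀ i : ℤ, ∀ n : ℕ, 2 ≤ n →
      Θ (i + 1) (n - 1) + Θ (i - 1) (n - 1) - Θ i (n - 2) + c i (n - 1)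
        ≤ Θ i n)
    (W : ℤ → ℕ → ℝ)
    (hW : ∀ i : ℤ, ∀ n : ℕ, 1 ≤ n → W i n = Θ i n - Θ (i + 1) (n - 1)) :
    ∀ i : ℤ, ∀ n : ℕ, 1 ≤ n →
      (W (i - (n : ℤ) + 1) 1 + ∑ l ∈ Finset.Icc 1 (n - 1), c (i + 1 - (l : ℤ)) (n - l)
          ≤ W i n)
        ∧ Θ i n = Θ (i + (n : ℤ)) 0 + ∑ k ∈ Finset.range n, W (i + (k : ℤ)) (n - k) := by
  have hW' : ∀ i n, W i (n + 1) = Θ i (n + 1) - Θ (i + 1) n := fun i n => hW i (n + 1) (by omega)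
  have hstep : ∀ i n, W (i - 1) (n + 1) + c i (n + 1) ≤ W i (n + 2) := by
    intro i n
    have hi : Θ (i + 1) (n + 1) + Θ (i - 1) (n + 1) - Θ i n + c i (n + 1) ≤ Θ i (n + 2) :=
      hineq i (n + 2) (by omega)
    rw [hW', hW', sub_add_cancel]
    linarith
  intro i n hn
  refine ⟨?_, eq_add_sum_antidiagonal hW' i n⟩
  obtain ⟨m, rfl⟩ := Nat.exists_eq_add_of_le' hn
  convert add_sum_diagonal_le hstep i m using 2
  · congr 1
    push_cast
    ring
  · rw [Nat.add_sub_cancel, ← Finset.Ico_add_one_right_eq_Icc, Finset.sum_Ico_eq_sum_range]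
    refine Finset.sum_congr (by simp) fun l _ => ?_
    congr 1
    · push_cast
      ring
    · omega
end
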